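/- arXiv:0802.2700 — 2 statements merged into one kernel-verified Lean document; each statement's English description precedes it below -/
import Mathlib

section
/- Let n ≥ 4, 1 ≤ ℓ ≤ n−3, let r_1,…,r_n > 0 and θ, α ∈ ℝ, set m = ∑_{i=1}^{ℓ} r_i − ∑_{i=ℓ+1}^{n−2} r_i, and assume the closing relations r_{n−1}sin α = r_n sin θ and r_{n−1}cos α = m − r_n cos θ. Define vectors δ¹, δ², δ³ ∈ (ℝ³)ⁿ by: δ¹ = (0,…,0, −r_n sin θ·(0,0,1), r_n sin θ·(0,0,1)); δ² has i-th entry r_i(0,0,1) for 1 ≤ i ≤ ℓ, −r_i(0,0,1) for ℓ+1 ≤ i ≤ n−2, (n−1)-st entry −(r_{n−1}m/(r_{n−1}+r_n))(0,0,1), and n-th entry −(r_n m/(r_{n−1}+r_n))(0,0,1); δ³ has i-th entry −r_i(0,1,0) for 1 ≤ i ≤ ℓ, r_i(0,1,0) for ℓ+1 ≤ i ≤ n−2, (n−1)-st entry (r_n sin θ, m − r_n cos θ, 0), and n-th entry (−r_n sin θ, r_n cos θ, 0). Then with respect to the inner product ⟨u,v⟩_r = ∑_{i=1}^n (1/r_i)⟨u_i,v_i⟩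 on (ℝ³)ⁿ, the vectors δ¹, δ², δ³ are pairwise orthogonal, and moreover ⟨δ²,δ²⟩_r = ((r_{n−1}+r_n)·∑_{j=1}^{n−2} r_j + m²)/(r_{n−1}+r_n) and ⟨δ³,δ³⟩_r = ∑_{j=1}^{n−2} r_j + r_{n−1} + r_n. -/
open scoped RealInnerProductSpace

noncomputable section

/-- Euclidean 3-space. -/
abbrev E3 : Type := EuclideanSpace ℝ (Fin 3)

/-- The canonical linear identification of `E3` with `Fin 3 → ℝ`. -/
def toPi3 : E3 ≃ₗ[ℝ] (Fin 3 → ℝ) := WithLp.linearEquiv 2 ℝ (Fin 3 → ℝ)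

/-- The vector in ℝ³ with the given three coordinates. -/
def v3 (x y z : ℝ) : E3 := toPi3.symm ![x, y, z]

/-- The weighted inner product `⟨u,v⟩_r = ∑ (1/r_i)⟨u_i,v_i⟩` on `n`-tuples of
vectors of ℝ³. -/
def winner (n : ℕ) (r : ℕ → ℝ) (u v : ℕ → E3) : ℝ :=
  ∑ i ∈ Finset.range n, (1 / r i) * ⟪u i, v i⟫

theorem inner_v3 (a b c x y z : ℝ) : ⟪v3 a b c, v3 x y z⟫ = a * x + b * y + c * z := by
  simp [v3, toPi3, PiLp.inner_apply, Fin.sum_univ_three, mul_comm]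

theorem winner_eq_sum_add (n : ℕ) (hn : 2 ≤ n) (r : ℕ → ℝ) (u v : ℕ → E3) :
    winner n r u v = ∑ i ∈ Finset.range (n - 2), (1 / r i) * ⟪u i, v i⟫ +
      (1 / r (n - 2)) * ⟪u (n - 2), v (n - 2)⟫ + (1 / r (n - 1)) * ⟪u (n - 1), v (n - 1)⟫ := by
  obtain ⟨k, rfl⟩ := Nat.exists_eq_add_of_le' hn
  simp [winner, Finset.sum_range_succ]

/-- The vectors `δ¹, δ², δ³` obtained by Gram–Schmidt from the infinitesimal rotations
about the coordinate axes are pairwise orthogonal for the weighted inner product, and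
their squared lengths are as computed in the paper.  Edges are indexed by `0, …, n-1`
(so the paper's `r_1, …, r_n` are `r 0, …, r (n-1)`). -/
theorem delta_orthogonal (n ℓ : ℕ) (hn : 4 ≤ n) (hl1 : 1 ≤ ℓ) (hl2 : ℓ ≤ n - 3)
    (r : ℕ → ℝ) (hr : ∀ i < n, 0 < r i) (θ α : ℝ)
    (m : ℝ) (hm : m = ∑ i ∈ Finset.range ℓ, r i - ∑ i ∈ Finset.Ico ℓ (n - 2), r i)
    (hclose1 : r (n - 2) * Real.sin α = r (n - 1) * Real.sin θ)
    (hclose2 : r (n - 2) * Real.cos α = m - r (n - 1) * Real.cos θ)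
    (δ₁ δ₂ δ₃ : ℕ → E3)
    (hδ₁a : ∀ i < n - 2, δ₁ i = 0)
    (hδ₁b : δ₁ (n - 2) = (-(r (n - 1) * Real.sin θ)) • v3 0 0 1)
    (hδ₁c : δ₁ (n - 1) = (r (n - 1) * Real.sin θ) • v3 0 0 1)
    (hδ₂a : ∀ i < ℓ, δ₂ i = r i • v3 0 0 1)
    (hδ₂b : ∀ i, ℓ ≤ i → i < n - 2 → δ₂ i = (-(r i)) • v3 0 0 1)
    (hδ₂c : δ₂ (n - 2) = (-(r (n - 2) * m / (r (n - 2) + r (n - 1)))) • v3 0 0 1)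
    (hδ₂d : δ₂ (n - 1) = (-(r (n - 1) * m / (r (n - 2) + r (n - 1)))) • v3 0 0 1)
    (hδ₃a : ∀ i < ℓ, δ₃ i = (-(r i)) • v3 0 1 0)
    (hδ₃b : ∀ i, ℓ ≤ i → i < n - 2 → δ₃ i = r i • v3 0 1 0)
    (hδ₃c : δ₃ (n - 2) = v3 (r (n - 1) * Real.sin θ) (m - r (n - 1) * Real.cos θ) 0)
    (hδ₃d : δ₃ (n - 1) = v3 (-(r (n - 1)) * Real.sin θ) (r (n - 1) * Real.cos θ) 0) :
    winner n r δ₁ δ₂ = 0 ∧ winner n r δ₁ δ₃ = 0 ∧ winner n r δ₂ δ₃ = 0 ∧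
    winner n r δ₂ δ₂ =
      ((r (n - 2) + r (n - 1)) * ∑ j ∈ Finset.range (n - 2), r j + m ^ 2) /
        (r (n - 2) + r (n - 1)) ∧
    winner n r δ₃ δ₃ = (∑ j ∈ Finset.range (n - 2), r j) + r (n - 2) + r (n - 1) := by
  have hD : 0 < r (n - 2) + r (n - 1) := by
    linarith [hr (n - 2) (by omega), hr (n - 1) (by omega)]
  have ha : r (n - 2) ≠ 0 := (hr (n - 2) (by omega)).ne'
  have hb : r (n - 1) ≠ 0 := (hr (n - 1) (by omega)).ne'
  have hn2 : 2 ≤ n := by omega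
  have h₁₂ : ∀ i ∈ Finset.range (n - 2), (1 / r i) * ⟪δ₁ i, δ₂ i⟫ = 0 := fun i hi ↦ by
    simp [hδ₁a i (Finset.mem_range.1 hi)]
  have h₁₃ : ∀ i ∈ Finset.range (n - 2), (1 / r i) * ⟪δ₁ i, δ₃ i⟫ = 0 := fun i hi ↦ by
    simp [hδ₁a i (Finset.mem_range.1 hi)]
  have h₂₃ : ∀ i ∈ Finset.range (n - 2), (1 / r i) * ⟪δ₂ i, δ₃ i⟫ = 0 := fun i hi ↦ by
    have hi' := Finset.mem_range.1 hi
    rcases lt_or_ge i ℓ with h | h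
    · simp [hδ₂a i h, hδ₃a i h, inner_smul_left, inner_smul_right, inner_v3]
    · simp [hδ₂b i h hi', hδ₃b i h hi', inner_smul_left, inner_smul_right, inner_v3]
  have h₂₂ : ∀ i ∈ Finset.range (n - 2), (1 / r i) * ⟪δ₂ i, δ₂ i⟫ = r i := fun i hi ↦ by
    have hi' := Finset.mem_range.1 hi
    have := (hr i (by omega)).ne'
    rcases lt_or_ge i ℓ with h | h
    · simp only [hδ₂a i h, real_inner_smul_left, real_inner_smul_right, inner_v3]
      field_simp
      ring
    · simp only [hδ₂b i h hi', real_inner_smul_left, real_inner_smul_right, inner_v3]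
      field_simp
      ring
  have h₃₃ : ∀ i ∈ Finset.range (n - 2), (1 / r i) * ⟪δ₃ i, δ₃ i⟫ = r i := fun i hi ↦ by
    have hi' := Finset.mem_range.1 hi
    have := (hr i (by omega)).ne'
    rcases lt_or_ge i ℓ with h | h
    · simp only [hδ₃a i h, real_inner_smul_left, real_inner_smul_right, inner_v3]
      field_simp
      ring
    · simp only [hδ₃b i h hi', real_inner_smul_left, real_inner_smul_right, inner_v3]
      field_simp
      ring
  simp only [winner_eq_sum_add n hn2]
  rw [Finset.sum_congr rfl h₁₂, Finset.sum_congr rfl h₁₃, Finset.sum_congr rfl h₂₃,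
    Finset.sum_congr rfl h₂₂, Finset.sum_congr rfl h₃₃]
  simp only [hδ₁b, hδ₁c, hδ₂c, hδ₂d, hδ₃c, hδ₃d, real_inner_smul_left, real_inner_smul_right,
    inner_v3, Finset.sum_const_zero]
  refine ⟨?_, by ring, by ring, ?_, ?_⟩
  · field_simp
    ring
  · field_simp
    ring
  · rw [← hclose1, ← hclose2]
    have hα := Real.sin_sq_add_cos_sq α
    have hθ := Real.sin_sq_add_cos_sq θ
    field_simp
    linear_combination r (n - 2) ^ 2 * r (n - 1) * hα + r (n - 2) * r (n - 1) ^ 2 * hθ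
end
end

section
/- Let r = (r_1,…,r_5) ∈ ℝ⁵ have positive entries. Then the image of the set {(e_1,…,e_5) ∈ (ℝ³)⁵ : ‖e_i‖ = r_i for all i and e_1 + ⋯ + e_5 = 0} under the map (e_1,…,e_5) ↦ (‖e_1+e_2‖, ‖e_4+e_5‖) is exactly the set {(x,y) ∈ ℝ² : |r_1−r_2| ≤ x ≤ r_1+r_2, |r_4−r_5| ≤ y ≤ r_4+r_5, y ≥ −x + r_3, y ≥ x − r_3, y ≤ x + r_3}. (This is the moment polytope of the toric bending action on the moduli space of closed pentagons with side lengths r.) -/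
/-- A vector splits as a sum of two vectors of prescribed lengths as soon as the three lengths
satisfy the triangle inequalities. -/
theorem exists_add_eq_of_norm_triangle {E : Type*} [NormedAddCommGroup E] [NormedSpace ℝ E]
    (hE : 1 < Module.rank ℝ E) (v : E) {a b : ℝ} (ha : 0 ≤ a)
    (h₁ : |a - b| ≤ ‖v‖) (h₂ : ‖v‖ ≤ a + b) :
    ∃ u w : E, ‖u‖ = a ∧ ‖w‖ = b ∧ u + w = v := by
  have : Nontrivial E := rank_pos_iff_nontrivial.mp (zero_lt_one.trans hE)
  obtain ⟨n, hn, hv⟩ : ∃ n : E, ‖n‖ = 1 ∧ v = ‖v‖ • n := by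
    rcases eq_or_ne v 0 with rfl | hv
    · obtain ⟨n, hn⟩ := exists_norm_eq E zero_le_one
      exact ⟨n, hn, by simp⟩
    · have hv' : ‖v‖ ≠ 0 := norm_ne_zero_iff.mpr hv
      exact ⟨‖v‖⁻¹ • v, by simp [norm_smul, hv'], by rw [smul_inv_smul₀ hv']⟩
  have hnorm (t : ℝ) : ‖t • n‖ = |t| := by rw [norm_smul, hn, mul_one, Real.norm_eq_abs]
  have hsub (t : ℝ) : ‖v - t • n‖ = |‖v‖ - t| := by
    conv_lhs => rw [hv, ← sub_smul, hnorm]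
  obtain ⟨hlow, hupp⟩ := abs_le.mp h₁
  have hb : b ∈ Set.Icc ‖v - a • n‖ ‖v - (-a) • n‖ := by
    rw [hsub, hsub, abs_of_nonneg (by linarith [norm_nonneg v] : 0 ≤ ‖v‖ - -a)]
    exact ⟨abs_le.mpr ⟨by linarith, by linarith⟩, by linarith⟩
  obtain ⟨u, hu, hub⟩ := (isPreconnected_sphere hE (0 : E) a).intermediate_value
    (f := fun u => ‖v - u‖) (a := a • n) (b := (-a) • n)
    (by simp [hnorm, abs_of_nonneg ha]) (by simp [norm_neg, hnorm, abs_of_nonneg ha])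
    (by fun_prop) hb
  exact ⟨u, v - u, by simpa using hu, hub, by abel⟩

/-- The image of the space of closed pentagon configurations with side lengths
`r 0, …, r 4` under the map recording the lengths of the two diagonals
`‖e 0 + e 1‖` and `‖e 3 + e 4‖` is exactly the moment polytope of the toric bending
action: the intersection of the rectangle
`[|r 0 − r 1|, r 0 + r 1] × [|r 3 − r 4|, r 3 + r 4]` with the region
`{y ≥ −x + r 2, y ≥ x − r 2, y ≤ x + r 2}`. -/
theorem pentagon_moment_polytope (r : Fin 5 → ℝ) (hr : ∀ i, 0 < r i) :
    {p : ℝ × ℝ | ∃ e : Fin 5 → EuclideanSpace ℝ (Fin 3),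
        (∀ i, ‖e i‖ = r i) ∧ (∑ i, e i = 0) ∧ p = (‖e 0 + e 1‖, ‖e 3 + e 4‖)} =
      {p : ℝ × ℝ | |r 0 - r 1| ≤ p.1 ∧ p.1 ≤ r 0 + r 1 ∧
        |r 3 - r 4| ≤ p.2 ∧ p.2 ≤ r 3 + r 4 ∧
        -p.1 + r 2 ≤ p.2 ∧ p.1 - r 2 ≤ p.2 ∧ p.2 ≤ p.1 + r 2} := by
  have hE : 1 < Module.rank ℝ (EuclideanSpace ℝ (Fin 3)) := by
    rw [← Module.finrank_eq_rank, finrank_euclideanSpace_fin]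
    norm_num
  ext ⟨x, y⟩
  simp only [Set.mem_ofPred_eq, Prod.mk.injEq]
  constructor
  · rintro ⟨e, he, hsum, rfl, rfl⟩
    have key : e 2 = -((e 0 + e 1) + (e 3 + e 4)) := by
      rw [Fin.sum_univ_five] at hsum
      rw [eq_neg_iff_add_eq_zero, ← hsum]
      abel
    have h2 : ‖(e 0 + e 1) + (e 3 + e 4)‖ = r 2 := by rw [← he 2, key, norm_neg]
    have hdiff (u w : EuclideanSpace ℝ (Fin 3)) : |‖u‖ - ‖w‖| ≤ ‖u + w‖ := by
      simpa using abs_norm_sub_norm_le u (-w)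
    have hd := abs_le.mp (hdiff (e 0 + e 1) (e 3 + e 4))
    have hs := norm_add_le (e 0 + e 1) (e 3 + e 4)
    rw [h2] at hd hs
    refine ⟨?_, ?_, ?_, ?_, by linarith, by linarith, by linarith⟩
    · simpa only [he] using hdiff (e 0) (e 1)
    · simpa only [he] using norm_add_le (e 0) (e 1)
    · simpa only [he] using hdiff (e 3) (e 4)
    · simpa only [he] using norm_add_le (e 3) (e 4)
  · rintro ⟨hx₁, hx₂, hy₁, hy₂, h₁, h₂, h₃⟩
    obtain ⟨v, hv⟩ := exists_norm_eq (EuclideanSpace ℝ (Fin 3)) (hr 2).le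
    obtain ⟨u, w, rfl, rfl, huw⟩ := exists_add_eq_of_norm_triangle hE v
      ((abs_nonneg _).trans hx₁) (b := y)
      (by rw [hv]; exact abs_le.mpr ⟨by linarith, by linarith⟩) (by linarith)
    obtain ⟨e₀, e₁, he₀, he₁, rfl⟩ := exists_add_eq_of_norm_triangle hE u (hr 0).le hx₁ hx₂
    obtain ⟨e₃, e₄, he₃, he₄, rfl⟩ := exists_add_eq_of_norm_triangle hE w (hr 3).le hy₁ hy₂
    refine ⟨![e₀, e₁, -v, e₃, e₄], ?_, ?_, rfl, rfl⟩
    · intro i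
      fin_cases i
      exacts [he₀, he₁, (norm_neg v).trans hv, he₃, he₄]
    · rw [Fin.sum_univ_five, ← huw]
      change e₀ + e₁ + -(e₀ + e₁ + (e₃ + e₄)) + e₃ + e₄ = 0
      abel
end
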